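/- Let S be a string of length n, let nss(i) = j and nss(i') = j' with j' ≤ n, let d = j' − i', and assume i' − d ≤ i < i', j ≤ i', and llce(i', j') > i' − i. Then nss(i + d) = j + d. -/

import Mathlib

open List

variable {α : Type*} [LinearOrder α]

/-- The substring `S[i..j]` (1-based, both endpoints inclusive). -/
def sub (S : ℕ → α) (i j : ℕ) : List α := (List.range' i (j + 1 - i)).map S

/-- The suffix `S_i = S[i..n]` (empty for `i = n + 1`). -/
def suf (S : ℕ → α) (n i : ℕ) : List α := sub S i n

/-- The prefix `S[1..i]`. -/
def pre (S : ℕ → α) (i : ℕ) : List α := sub S 1 i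

/-- Strict lexicographic order `≺` on strings. -/
def slt (l₁ l₂ : List α) : Prop := List.Lex (· < ·) l₁ l₂

/-- Length of the longest common prefix of two lists. -/
def lcpLen (l₁ l₂ : List α) : ℕ :=
  Nat.findGreatest (fun k => l₁.take k = l₂.take k) (min l₁.length l₂.length)

/-- `rlce S n i j` : length of the longest common prefix of suffixes `S_i` and `S_j`. -/
def rlce (S : ℕ → α) (n i j : ℕ) : ℕ := lcpLen (suf S n i) (suf S n j)

/-- `llce S i j` : length of the longest common suffix of prefixes `S[1..i]` and `S[1..j]`. -/
def llce (S : ℕ → α) (i j : ℕ) : ℕ := lcpLen (pre S i).reverse (pre S j).reverse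

/-- Next-smaller-suffix array: `nss S n i = min { j | j = n+1 ∨ (i < j ≤ n ∧ S_j ≺ S_i) }`. -/
noncomputable def nss (S : ℕ → α) (n i : ℕ) : ℕ :=
  sInf {j | j = n + 1 ∨ (i < j ∧ j ≤ n ∧ slt (suf S n j) (suf S n i))}

/-- A Lyndon word: nonempty and strictly smaller than each of its non-trivial cyclic shifts. -/
def IsLyndon (l : List α) : Prop :=
  l ≠ [] ∧ ∀ k, 0 < k → k < l.length → slt l (l.drop k ++ l.take k)

/-- The Lyndon array: `lyn S n i = max { j - i + 1 | i ≤ j ≤ n, S[i..j] is a Lyndon word }`. -/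
noncomputable def lyn (S : ℕ → α) (n i : ℕ) : ℕ :=
  sSup {m | ∃ j, i ≤ j ∧ j ≤ n ∧ IsLyndon (sub S i j) ∧ m = j - i + 1}

/-- `p ≥ 1` is a period of `S[i..j]`: `S[x] = S[x+p]` for all `x ∈ [i, j - p]`. -/
def IsPeriod (S : ℕ → α) (i j p : ℕ) : Prop :=
  1 ≤ p ∧ ∀ x, i ≤ x → x + p ≤ j → S x = S (x + p)

/-- A run `(i,j,p)` in a string of length `n`. -/
def IsRun (S : ℕ → α) (n i j p : ℕ) : Prop :=
  1 ≤ i ∧ i ≤ j ∧ j ≤ n ∧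
  IsPeriod S i j p ∧ (∀ q, 1 ≤ q → q < p → ¬ IsPeriod S i j q) ∧
  2 * p ≤ j - i + 1 ∧
  (1 < i → ¬ IsPeriod S (i - 1) j p) ∧
  (j < n → ¬ IsPeriod S i (j + 1) p)

/-- A (lexicographically) decreasing run: a run with `S_i ≻ S_{i+p}`. -/
def IsDecRun (S : ℕ → α) (n i j p : ℕ) : Prop :=
  IsRun S n i j p ∧ slt (suf S n (i + p)) (suf S n i)

omit [LinearOrder α] in
theorem suf_eq_cons (S : ℕ → α) {n a : ℕ} (h : a ≤ n) :
    suf S n a = S a :: suf S n (a + 1) := by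
  unfold suf sub
  rw [show n + 1 - a = (n + 1 - (a + 1)) + 1 by omega, List.range'_succ]
  simp

omit [LinearOrder α] in
theorem length_suf (S : ℕ → α) (n a : ℕ) : (suf S n a).length = n + 1 - a := by
  simp [suf, sub]

omit [LinearOrder α] in
theorem eq_of_suf_eq_suf (S : ℕ → α) {n a b : ℕ} (ha : a ≤ n) (hb : b ≤ n)
    (h : suf S n a = suf S n b) : a = b := by
  have := congrArg List.length h
  rw [length_suf, length_suf] at this
  omega

theorem suf_lt_suf_shift (S : ℕ → α) {n : ℕ} (m : ℕ) {a b : ℕ} (ha : a + m ≤ n) (hb : b + m ≤ n)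
    (h : ∀ t < m, S (a + t) = S (b + t)) :
    suf S n a < suf S n b ↔ suf S n (a + m) < suf S n (b + m) := by
  induction m with
  | zero => rfl
  | succ m ih =>
    rw [ih (by omega) (by omega) fun t ht => h t (by omega),
      suf_eq_cons S (by omega : a + m ≤ n), suf_eq_cons S (by omega : b + m ≤ n),
      List.cons_lt_cons_iff, h m (by omega)]
    simp [add_assoc]

theorem suf_lt_suf_of_mismatch (S : ℕ → α) {n m a b : ℕ} (ha : a + m ≤ n) (hb : b + m ≤ n)
    (h : ∀ t < m, S (a + t) = S (b + t)) (hm : S (a + m) ≠ S (b + m)) :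
    suf S n a < suf S n b ↔ S (a + m) < S (b + m) := by
  rw [suf_lt_suf_shift S m ha hb h, suf_eq_cons S ha, suf_eq_cons S hb, List.cons_lt_cons_iff]
  simp [hm]

/-- If `S[x..y] = S[x+d..y+d]`, then suffixes starting in `[x..y]` either agree up to
position `y`, or compare in the same way as their translates by `d`. -/
theorem agree_or_suf_lt_suf_translate (S : ℕ → α) {n x y d a b : ℕ} (hn : y + d ≤ n)
    (hS : ∀ t, x ≤ t → t ≤ y → S t = S (t + d)) (ha : x ≤ a) (hab : a < b) :
    (∀ t, b + t ≤ y → S (a + t) = S (b + t)) ∨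
      ((suf S n a < suf S n b ↔ suf S n (a + d) < suf S n (b + d)) ∧
        (suf S n b < suf S n a ↔ suf S n (b + d) < suf S n (a + d))) := by
  classical
  by_cases hex : ∃ t, b + t ≤ y ∧ S (a + t) ≠ S (b + t)
  · right
    obtain ⟨hy, hne⟩ := Nat.find_spec hex
    have hlt := fun t => Nat.find_min hex (m := t)
    generalize Nat.find hex = m at hy hne hlt
    have heq : ∀ t < m, S (a + t) = S (b + t) := fun t ht => by
      by_contra hc
      exact hlt t ht ⟨by omega, hc⟩
    have htr : ∀ t ≤ m, S (a + t) = S (a + d + t) ∧ S (b + t) = S (b + d + t) := fun t ht => by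
      rw [hS (a + t) (by omega) (by omega), hS (b + t) (by omega) (by omega)]
      constructor <;> congr 1 <;> omega
    have heq' : ∀ t < m, S (a + d + t) = S (b + d + t) := fun t ht => by
      rw [← (htr t ht.le).1, ← (htr t ht.le).2, heq t ht]
    have hne' : S (a + d + m) ≠ S (b + d + m) := by
      rwa [← (htr m le_rfl).1, ← (htr m le_rfl).2]
    rw [suf_lt_suf_of_mismatch S (by omega) (by omega) heq hne,
      suf_lt_suf_of_mismatch S (by omega) (by omega) heq' hne',
      suf_lt_suf_of_mismatch S (by omega) (by omega) (fun t ht => (heq t ht).symm) hne.symm,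
      suf_lt_suf_of_mismatch S (by omega) (by omega) (fun t ht => (heq' t ht).symm) hne'.symm,
      (htr m le_rfl).1, (htr m le_rfl).2]
    exact ⟨Iff.rfl, Iff.rfl⟩
  · left
    push Not at hex
    exact hex

theorem getElem?_eq_of_lt_lcpLen {l₁ l₂ : List α} {t : ℕ} (h : t < lcpLen l₁ l₂) :
    l₁[t]? = l₂[t]? := by
  have hs : l₁.take (lcpLen l₁ l₂) = l₂.take (lcpLen l₁ l₂) :=
    Nat.findGreatest_spec (P := fun k => l₁.take k = l₂.take k) (Nat.zero_le _) (by simp)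
  have := congrArg (fun l => l[t]?) hs
  simpa [List.getElem?_take, h] using this

omit [LinearOrder α] in
theorem getElem?_reverse_pre (S : ℕ → α) {i t : ℕ} (h : t < i) :
    (pre S i).reverse[t]? = some (S (i - t)) := by
  rw [List.getElem?_reverse (by simpa [pre, sub] using h)]
  simp only [pre, sub, List.getElem?_map, List.length_map, List.length_range']
  rw [List.getElem?_range' (by omega)]
  simp only [Option.map_some]
  congr 2
  omega

theorem eq_of_lt_llce (S : ℕ → α) {i j t : ℕ} (h : t < llce S i j) (hi : t < i) (hj : t < j) :
    S (i - t) = S (j - t) := by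
  have := getElem?_eq_of_lt_lcpLen h
  rw [getElem?_reverse_pre S hi, getElem?_reverse_pre S hj] at this
  exact Option.some.inj this

theorem nss_eq_iff (S : ℕ → α) {n i j : ℕ} (hj : j ≤ n) :
    nss S n i = j ↔ i < j ∧ suf S n j < suf S n i ∧
      ∀ k, i < k → k < j → suf S n i < suf S n k := by
  constructor
  · rintro rfl
    have hmem := Nat.sInf_mem
      (s := {j | j = n + 1 ∨ (i < j ∧ j ≤ n ∧ slt (suf S n j) (suf S n i))}) ⟨n + 1, Or.inl rfl⟩
    rcases hmem with h | ⟨h, -, hlt⟩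
    · change nss S n i = n + 1 at h
      omega
    · refine ⟨h, hlt, fun k hik hk => ?_⟩
      refine lt_of_le_of_ne (not_lt.1 fun hc => ?_) fun he => ?_
      · exact Nat.notMem_of_lt_sInf hk (Or.inr ⟨hik, by omega, hc⟩)
      · exact hik.ne (eq_of_suf_eq_suf S (by omega) (by omega) he)
  · rintro ⟨hij, hlt, hmin⟩
    refine IsLeast.csInf_eq ⟨Or.inr ⟨hij, hj, hlt⟩, ?_⟩
    rintro k (rfl | ⟨hik, -, hk⟩)
    · omega
    · exact not_lt.1 fun hc => lt_asymm (hmin k hik hc) hk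

/-- With `nss(i) = j`, `nss(i') = j' ≤ n`, `d = j' - i'`, `i' - d ≤ i < i'`,
`j ≤ i'`, and `llce(i',j') > i' - i`, it holds `nss(i + d) = j + d`. -/
theorem stmt_16 (S : ℕ → α) (n i j i' j' d : ℕ)
    (hi1 : 1 ≤ i) (hi'1 : 1 ≤ i')
    (h1 : nss S n i = j) (h2 : nss S n i' = j') (h2n : j' ≤ n)
    (hd : d = j' - i')
    (h3 : i' - d ≤ i) (h4 : i < i') (h5 : j ≤ i')
    (h6 : i' - i < llce S i' j') :
    nss S n (i + d) = j + d := by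
  obtain ⟨hij', hlt', hmin'⟩ := (nss_eq_iff S h2n).1 h2
  obtain ⟨hij, hlt, hmin⟩ := (nss_eq_iff S (by omega)).1 h1
  obtain rfl : j' = i' + d := by omega
  have hS : ∀ t, i ≤ t → t ≤ i' → S t = S (t + d) := fun t hit hti => by
    have := eq_of_lt_llce S (t := i' - t) (lt_of_le_of_lt (by omega) h6) (by omega) (by omega)
    rwa [show i' - (i' - t) = t by omega, show i' + d - (i' - t) = t + d by omega] at this
  rw [nss_eq_iff S (by omega)]
  refine ⟨by omega, ?_, fun k hk hkj => ?_⟩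
  · rcases agree_or_suf_lt_suf_translate S h2n hS le_rfl hij with hag | ⟨-, h⟩
    · rw [suf_lt_suf_shift S (i' - j) (by omega) (by omega) fun t ht => ?_,
        show j + d + (i' - j) = i' + d by omega]
      · rcases (show i' ≤ i + d + (i' - j) by omega).eq_or_lt with he | hlt''
        · rwa [← he]
        · exact hlt'.trans (hmin' _ hlt'' (by omega))
      · rw [show j + d + t = j + t + d by omega, show i + d + t = i + t + d by omega,
          ← hS _ (by omega) (by omega), ← hS _ (by omega) (by omega), hag t (by omega)]
    · exact h.1 hlt
  · obtain ⟨k, rfl⟩ : ∃ k₀, k = k₀ + d := ⟨k - d, by omega⟩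
    have hik : i < k := by omega
    rcases agree_or_suf_lt_suf_translate S h2n hS le_rfl hik with hag | ⟨h, -⟩
    · have hshift := (suf_lt_suf_shift S (j - k) (by omega) (by omega) fun t ht =>
        hag t (by omega)).1 (hmin k hik (by omega))
      rw [show k + (j - k) = j by omega] at hshift
      exact absurd ((hmin _ (by omega) (by omega)).trans hshift) (lt_asymm hlt)
    · exact h.1 (hmin k hik (by omega))
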